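/- There exists a Peano curve γ : [0,1] → ℝ² such that for every t ∈ [0,1] the set γ([0,t]) is convex. -/

import Mathlib

open Metric Set
open scoped RealInnerProductSpace

section StronglyConvex

variable {E : Type*} [NormedAddCommGroup E]

/-- `K` is strongly convex with modulus `κ`: with any two of its points it contains the balls of
radius `κ / 2 * a * b * ‖x - y‖ ^ 2` about their convex combinations `a • x + b • y`. -/
def StronglyConvexSet [NormedSpace ℝ E] (κ : ℝ) (K : Set E) : Prop :=
  ∀ x ∈ K, ∀ y ∈ K, ∀ a b : ℝ, 0 ≤ a → 0 ≤ b → a + b = 1 →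
    closedBall (a • x + b • y) (κ / 2 * (a * b * ‖x - y‖ ^ 2)) ⊆ K

/-- The smallest closed strongly convex set of modulus `κ` containing `A`. -/
def strongHull [NormedSpace ℝ E] (κ : ℝ) (A : Set E) : Set E :=
  ⋂₀ {C | IsClosed C ∧ StronglyConvexSet κ C ∧ A ⊆ C}

/-- The points `(1 - s) • x + s • y` with `x ∈ K` and `y ∈ L`. -/
def interpolate [NormedSpace ℝ E] (K L : Set E) (s : ℝ) : Set E :=
  (fun p : E × E => (1 - s) • p.1 + s • p.2) '' K ×ˢ L

section NormedSpace

variable [NormedSpace ℝ E] {κ κ' : ℝ} {K L A : Set E}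

theorem StronglyConvexSet.mono (h : StronglyConvexSet κ K) (hle : κ' ≤ κ) :
    StronglyConvexSet κ' K := by
  intro x hx y hy a b ha hb hab
  refine (closedBall_subset_closedBall ?_).trans (h x hx y hy a b ha hb hab)
  have : 0 ≤ a * b * ‖x - y‖ ^ 2 := by positivity
  nlinarith

theorem StronglyConvexSet.convex (h : StronglyConvexSet κ K) (hκ : 0 ≤ κ) : Convex ℝ K := by
  intro x hx y hy a b ha hb hab
  exact h x hx y hy a b ha hb hab (mem_closedBall_self (by positivity))

theorem stronglyConvexSet_singleton (κ : ℝ) (x : E) : StronglyConvexSet κ {x} := by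
  rintro _ rfl _ rfl a b - - hab
  rw [← add_smul, hab]
  simp

theorem stronglyConvexSet_strongHull (κ : ℝ) (A : Set E) :
    StronglyConvexSet κ (strongHull κ A) := by
  intro x hx y hy a b ha hb hab z hz C hC
  exact hC.2.1 x (hx C hC) y (hy C hC) a b ha hb hab hz

theorem isClosed_strongHull (κ : ℝ) (A : Set E) : IsClosed (strongHull κ A) :=
  isClosed_sInter fun _ hC => hC.1

theorem subset_strongHull (κ : ℝ) (A : Set E) : A ⊆ strongHull κ A :=
  subset_sInter fun _ hC => hC.2.2

theorem strongHull_subset (hc : IsClosed L) (hL : StronglyConvexSet κ L) (h : A ⊆ L) :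
    strongHull κ A ⊆ L :=
  sInter_subset_of_mem ⟨hc, hL, h⟩

theorem interpolate_zero (hL : L.Nonempty) : interpolate K L 0 = K := by
  obtain ⟨y, hy⟩ := hL
  ext z
  constructor
  · rintro ⟨⟨p, q⟩, ⟨hp, -⟩, rfl⟩
    simpa using hp
  · intro hz
    exact ⟨(z, y), ⟨hz, hy⟩, by simp⟩

theorem interpolate_one (hK : K.Nonempty) : interpolate K L 1 = L := by
  obtain ⟨y, hy⟩ := hK
  ext z
  constructor
  · rintro ⟨⟨p, q⟩, ⟨-, hq⟩, rfl⟩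
    simpa using hq
  · intro hz
    exact ⟨(y, z), ⟨hy, hz⟩, by simp⟩

theorem interpolate_mono (hKL : K ⊆ L) (hL : Convex ℝ L) {s t : ℝ} (hs : 0 ≤ s) (hst : s ≤ t) :
    interpolate K L s ⊆ interpolate K L t := by
  rintro _ ⟨⟨x, y⟩, ⟨hx, hy⟩, rfl⟩
  rcases hs.eq_or_lt with rfl | hs
  · refine ⟨(x, x), ⟨hx, hKL hx⟩, ?_⟩
    simp [← add_smul]
  · have ht : 0 < t := hs.trans_le hst
    refine ⟨(x, ((t - s) / t) • x + (s / t) • y), ⟨hx, hL (hKL hx) hy ?_ ?_ ?_⟩, ?_⟩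
    · exact div_nonneg (by linarith) ht.le
    · positivity
    · field_simp
      ring
    · simp only [smul_add, smul_smul, mul_div_cancel₀ _ ht.ne']
      rw [← add_assoc, ← add_smul]
      congr 2
      ring

theorem isCompact_interpolate (hK : IsCompact K) (hL : IsCompact L) (s : ℝ) :
    IsCompact (interpolate K L s) :=
  (hK.prod hL).image (by fun_prop)

theorem norm_sq_combo_le {s : ℝ} (h0 : 0 ≤ s) (h1 : s ≤ 1) (u v : E) :
    ‖(1 - s) • u + s • v‖ ^ 2 ≤ (1 - s) * ‖u‖ ^ 2 + s * ‖v‖ ^ 2 := by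
  have h : ‖(1 - s) • u + s • v‖ ≤ (1 - s) * ‖u‖ + s * ‖v‖ := by
    refine (norm_add_le _ _).trans_eq ?_
    rw [norm_smul, norm_smul, Real.norm_of_nonneg (by linarith), Real.norm_of_nonneg h0]
  have h2 := pow_le_pow_left₀ (norm_nonneg _) h 2
  nlinarith [mul_nonneg (mul_nonneg h0 (sub_nonneg.2 h1)) (sq_nonneg (‖u‖ - ‖v‖))]

theorem StronglyConvexSet.interpolate (hκ : 0 ≤ κ) (hK : StronglyConvexSet κ K)
    (hL : StronglyConvexSet κ L) {s : ℝ} (h0 : 0 ≤ s) (h1 : s ≤ 1) :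
    StronglyConvexSet κ (interpolate K L s) := by
  rintro _ ⟨⟨x₁, x₂⟩, ⟨hx₁, hx₂⟩, rfl⟩ _ ⟨⟨y₁, y₂⟩, ⟨hy₁, hy₂⟩, rfl⟩ a b ha hb hab z hz
  simp only at hx₁ hx₂ hy₁ hy₂ hz
  rw [mem_closedBall, dist_eq_norm] at hz
  set e := z - (a • ((1 - s) • x₁ + s • x₂) + b • ((1 - s) • y₁ + s • y₂)) with he
  set ρ₁ := κ / 2 * (a * b * ‖x₁ - y₁‖ ^ 2) with hρ₁
  set ρ₂ := κ / 2 * (a * b * ‖x₂ - y₂‖ ^ 2) with hρ₂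
  have hρ₁0 : 0 ≤ ρ₁ := by positivity
  have hρ₂0 : 0 ≤ ρ₂ := by positivity
  set T := (1 - s) * ρ₁ + s * ρ₂ with hT
  have hT0 : 0 ≤ T := add_nonneg (mul_nonneg (sub_nonneg.2 h1) hρ₁0) (mul_nonneg h0 hρ₂0)
  have heT : ‖e‖ ≤ T := by
    refine hz.trans ?_
    have key := norm_sq_combo_le h0 h1 (x₁ - y₁) (x₂ - y₂)
    have hxy : (1 - s) • x₁ + s • x₂ - ((1 - s) • y₁ + s • y₂)
        = (1 - s) • (x₁ - y₁) + s • (x₂ - y₂) := by module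
    rw [hxy]
    calc _ ≤ κ / 2 * (a * b * ((1 - s) * ‖x₁ - y₁‖ ^ 2 + s * ‖x₂ - y₂‖ ^ 2)) := by gcongr
      _ = T := by rw [hT, hρ₁, hρ₂]; ring
  have hball : ∀ ρ : ℝ, 0 ≤ ρ → ‖(ρ / T) • e‖ ≤ ρ := by
    intro ρ hρ
    rw [norm_smul, Real.norm_of_nonneg (by positivity)]
    calc ρ / T * ‖e‖ ≤ ρ / T * T := by gcongr
      _ ≤ ρ := by
        rw [div_mul_eq_mul_div]
        exact div_le_of_le_mul₀ hT0 hρ le_rfl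
  refine ⟨(a • x₁ + b • y₁ + (ρ₁ / T) • e, a • x₂ + b • y₂ + (ρ₂ / T) • e), ⟨?_, ?_⟩, ?_⟩
  · exact hK x₁ hx₁ y₁ hy₁ a b ha hb hab
      (by simpa [mem_closedBall, dist_eq_norm] using hball _ hρ₁0)
  · exact hL x₂ hx₂ y₂ hy₂ a b ha hb hab
      (by simpa [mem_closedBall, dist_eq_norm] using hball _ hρ₂0)
  · have hsum : ((1 - s) * (ρ₁ / T) + s * (ρ₂ / T)) • e = e := by
      rcases hT0.eq_or_lt with h | h
      · have : e = 0 := norm_le_zero_iff.1 (by rw [h]; exact heT)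
        simp [this]
      · rw [← mul_div_assoc, ← mul_div_assoc, ← add_div, ← hT, div_self h.ne', one_smul]
    have hz' : z = (a • ((1 - s) • x₁ + s • x₂) + b • ((1 - s) • y₁ + s • y₂))
        + ((1 - s) * (ρ₁ / T) + s * (ρ₂ / T)) • e := by
      rw [hsum, he]; abel
    rw [hz']
    simp only
    module

end NormedSpace

variable [InnerProductSpace ℝ E] {κ : ℝ} {K M S : Set E}

theorem norm_sq_combo (x y : E) {a b : ℝ} (hab : a + b = 1) :
    ‖a • x + b • y‖ ^ 2 = a * ‖x‖ ^ 2 + b * ‖y‖ ^ 2 - a * b * ‖x - y‖ ^ 2 := by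
  rw [norm_add_sq_real, norm_sub_sq_real, norm_smul, norm_smul, real_inner_smul_left,
    real_inner_smul_right, mul_pow, mul_pow, Real.norm_eq_abs, Real.norm_eq_abs, sq_abs, sq_abs]
  obtain rfl : b = 1 - a := by linarith
  ring

theorem stronglyConvexSet_closedBall (c : E) {κ R : ℝ} (hR : 0 ≤ R) (h : κ * R = 1) :
    StronglyConvexSet κ (closedBall c R) := by
  intro x hx y hy a b ha hb hab z hz
  rw [mem_closedBall, dist_eq_norm] at *
  set q := a * b * ‖x - y‖ ^ 2 with hq
  have hq0 : 0 ≤ q := by positivity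
  have hm : ‖a • x + b • y - c‖ ^ 2 ≤ R ^ 2 - q := by
    have h1 : a • x + b • y - c = a • (x - c) + b • (y - c) := by
      obtain rfl : b = 1 - a := by linarith
      module
    rw [h1, norm_sq_combo _ _ hab, sub_sub_sub_cancel_right]
    have hx2 := pow_le_pow_left₀ (norm_nonneg _) hx 2
    have hy2 := pow_le_pow_left₀ (norm_nonneg _) hy 2
    have : R ^ 2 = a * R ^ 2 + b * R ^ 2 := by rw [← add_mul, hab, one_mul]
    rw [this]
    gcongr
  have hκ : 0 ≤ κ := by
    by_contra! hn
    nlinarith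
  have hqR : q ≤ R ^ 2 := by nlinarith [sq_nonneg ‖a • x + b • y - c‖]
  have hκq : κ * q ≤ R := by
    calc κ * q ≤ κ * R ^ 2 := by gcongr
      _ = R := by rw [pow_two, ← mul_assoc, h, one_mul]
  have hle : ‖a • x + b • y - c‖ ≤ R - κ / 2 * q := by
    refine le_of_sq_le_sq ?_ (by linarith)
    refine hm.trans ?_
    have : (R - κ / 2 * q) ^ 2 = R ^ 2 - (κ * R) * q + (κ / 2 * q) ^ 2 := by ring
    rw [this, h]
    nlinarith [sq_nonneg (κ / 2 * q)]
  calc ‖z - c‖ = ‖(z - (a • x + b • y)) + (a • x + b • y - c)‖ := by rw [sub_add_sub_cancel]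
    _ ≤ _ := norm_add_le _ _
    _ ≤ R := by linarith

theorem StronglyConvexSet.exists_supporting (hκ : 0 ≤ κ) (hK : StronglyConvexSet κ K)
    (hc : IsComplete K) (hne : K.Nonempty) {z : E} (hz : z ∉ K) :
    ∃ x ∈ K, ∃ u : E, ‖u‖ = 1 ∧ z = x + dist z x • u ∧ (∀ y ∈ K, dist z x ≤ dist z y) ∧
      ∀ y ∈ K, κ / 2 * ‖x - y‖ ^ 2 ≤ ⟪x - y, u⟫ := by
  obtain ⟨x, hx, hmin⟩ := exists_norm_eq_iInf_of_complete_convex hne hc (hK.convex hκ) z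
  have hinner := (norm_eq_iInf_iff_real_inner_le_zero (hK.convex hκ) hx).1 hmin
  have hτ : 0 < ‖z - x‖ := norm_pos_iff.2 (sub_ne_zero.2 fun h => hz (h ▸ hx))
  obtain ⟨u, hu1, hzu⟩ : ∃ u : E, ‖u‖ = 1 ∧ z - x = ‖z - x‖ • u := by
    refine ⟨‖z - x‖⁻¹ • (z - x), ?_, ?_⟩
    · rw [norm_smul, norm_inv, norm_norm, inv_mul_cancel₀ hτ.ne']
    · rw [smul_smul, mul_inv_cancel₀ hτ.ne', one_smul]
  refine ⟨x, hx, u, hu1, ?_, ?_, ?_⟩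
  · rw [dist_eq_norm, ← hzu]; abel
  · intro y hy
    rw [dist_eq_norm, dist_eq_norm, hmin]
    exact ciInf_le ⟨0, by rintro _ ⟨w, rfl⟩; positivity⟩ (⟨y, hy⟩ : K)
  · intro y hy
    have key : ∀ t ∈ Ioo (0 : ℝ) 1, (1 - t) * (κ / 2 * ‖x - y‖ ^ 2) ≤ ⟪x - y, u⟫ := by
      intro t ht
      set ρ := κ / 2 * ((1 - t) * t * ‖x - y‖ ^ 2) with hρ
      have hρ0 : 0 ≤ ρ := by
        have := ht.1.le
        have := sub_nonneg.2 ht.2.le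
        positivity
      have hw : (1 - t) • x + t • y + ρ • u ∈ K :=
        hK x hx y hy (1 - t) t (by linarith [ht.2]) ht.1.le (by ring) (by
          simp [mem_closedBall, dist_eq_norm, norm_smul, hu1, abs_of_nonneg hρ0, ← hρ])
      have h := hinner _ hw
      have hw' : (1 - t) • x + t • y + ρ • u - x = ρ • u - t • (x - y) := by module
      rw [hw', hzu, real_inner_smul_left, inner_sub_right, real_inner_smul_right,
        real_inner_smul_right, real_inner_self_eq_norm_sq, hu1, real_inner_comm] at h
      have h' := nonpos_of_mul_nonpos_right h hτ
      have h3 : t * ((1 - t) * (κ / 2 * ‖x - y‖ ^ 2)) ≤ t * ⟪x - y, u⟫ := by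
        have : t * ((1 - t) * (κ / 2 * ‖x - y‖ ^ 2)) = ρ := by rw [hρ]; ring
        linarith
      exact le_of_mul_le_mul_left h3 ht.1
    refine le_of_tendsto (x := nhdsWithin (0 : ℝ) (Ioi 0))
      (f := fun t : ℝ => (1 - t) * (κ / 2 * ‖x - y‖ ^ 2)) ?_ ?_
    · have : Filter.Tendsto (fun t : ℝ => (1 - t) * (κ / 2 * ‖x - y‖ ^ 2)) (nhds 0)
          (nhds ((1 - 0) * (κ / 2 * ‖x - y‖ ^ 2))) :=
        Continuous.tendsto (by fun_prop) 0
      rw [sub_zero, one_mul] at this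
      exact this.mono_left nhdsWithin_le_nhds
    · filter_upwards [Ioo_mem_nhdsGT one_pos] with t ht using key t ht

/-- Weakening the modulus makes the strong hull local: adding points of `S` close to `K` only
creates new points near `S`. -/
theorem exists_dist_le_of_mem_strongHull (hκ : 0 < κ) (hK : StronglyConvexSet κ K)
    (hKc : IsComplete K) (hne : K.Nonempty) (hM : StronglyConvexSet κ M) (hMc : IsClosed M)
    (hKM : K ⊆ M) (hSM : S ⊆ M) {δ η : ℝ} (hδη : δ ≤ η / 8) (hδκ : δ ≤ κ * η ^ 2 / 16)
    (hη : 0 < η) (hMK : ∀ w ∈ M, ∃ y ∈ K, dist w y ≤ δ) {z : E}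
    (hz : z ∈ strongHull (κ / 2) (K ∪ S)) (hzK : z ∉ K) : ∃ s ∈ S, dist z s ≤ η := by
  by_contra! hfar
  have hzM : z ∈ M := strongHull_subset hMc (hM.mono (by linarith)) (union_subset hKM hSM) hz
  obtain ⟨x, hx, u, hu, hzx, hmin, hsupp⟩ := hK.exists_supporting hκ.le hKc hne hzK
  have hτ : 0 < dist z x := dist_pos.2 fun h => hzK (h ▸ hx)
  have hτδ : dist z x ≤ δ := by
    obtain ⟨y, hy, hzy⟩ := hMK z hzM
    exact (hmin y hy).trans hzy
  set R := 2 / κ with hR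
  have hR0 : 0 < R := by positivity
  have hκR : κ * R = 2 := by rw [hR]; field_simp
  have hball : ∀ w : E, κ / 4 * ‖x - w‖ ^ 2 ≤ ⟪x - w, u⟫ → w ∈ closedBall (x - R • u) R := by
    intro w hw
    rw [mem_closedBall, dist_eq_norm]
    refine le_of_sq_le_sq ?_ hR0.le
    have : w - (x - R • u) = R • u - (x - w) := by abel
    rw [this, norm_sub_sq_real, real_inner_smul_left, norm_smul, hu, Real.norm_of_nonneg hR0.le,
      real_inner_comm]
    nlinarith [mul_le_mul_of_nonneg_left hw hR0.le]
  have hsub : strongHull (κ / 2) (K ∪ S) ⊆ closedBall (x - R • u) R := by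
    refine strongHull_subset isClosed_closedBall
      (stronglyConvexSet_closedBall _ hR0.le (by linarith)) (union_subset ?_ ?_)
    · intro y hy
      refine hball y (le_trans ?_ (hsupp y hy))
      gcongr
      norm_num
    · intro s hs
      obtain ⟨y, hy, hsy⟩ := hMK s (hSM hs)
      apply hball
      have h1 : ⟪x - y, u⟫ - δ ≤ ⟪x - s, u⟫ := by
        have h := real_inner_le_norm (s - y) u
        rw [hu, mul_one, ← dist_eq_norm] at h
        have : ⟪x - y, u⟫ = ⟪x - s, u⟫ + ⟪s - y, u⟫ := by
          rw [← inner_add_left, sub_add_sub_cancel]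
        linarith
      have h2 : ‖x - s‖ ≤ ‖x - y‖ + δ := by
        rw [← dist_eq_norm, ← dist_eq_norm]
        linarith [dist_triangle x y s, dist_comm s y]
      have h3 : 3 * η / 4 ≤ ‖x - y‖ := by
        rw [← dist_eq_norm]
        linarith [dist_triangle4 z x y s, dist_comm s y, hfar s hs]
      have h4 := hsupp y hy
      have h5 : ‖x - s‖ ^ 2 ≤ (‖x - y‖ * (7 / 6)) ^ 2 := by
        gcongr
        linarith
      have h6 : (3 * η / 4) ^ 2 ≤ ‖x - y‖ ^ 2 := by gcongr
      nlinarith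
  have hzR := hsub hz
  rw [mem_closedBall, dist_eq_norm] at hzR
  have : z - (x - R • u) = (dist z x + R) • u := by
    nth_rewrite 1 [hzx]
    module
  rw [this, norm_smul, hu, Real.norm_of_nonneg (by positivity)] at hzR
  linarith

end StronglyConvex

section Growth

variable {E : Type*} [NormedAddCommGroup E] [InnerProductSpace ℝ E] {K L M : Set E}

/-- A nonempty compact set that is strongly convex of some positive modulus. -/
structure IsStrongBody (K : Set E) : Prop where
  isCompact : IsCompact K
  nonempty : K.Nonempty
  exists_modulus : ∃ κ > 0, StronglyConvexSet κ K

theorem IsStrongBody.convex (h : IsStrongBody K) : Convex ℝ K := by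
  obtain ⟨κ, hκ, hK⟩ := h.exists_modulus
  exact hK.convex hκ.le

/-- `L` is obtained from `K` by adding points close to one point of `K`. -/
structure LocalGrowth (η : ℝ) (K L : Set E) : Prop where
  left : IsStrongBody K
  right : IsStrongBody L
  subset : K ⊆ L
  exists_near : ∃ q ∈ K, L ⊆ K ∪ closedBall q η

theorem subset_of_reflTransGen_localGrowth {η : ℝ}
    (h : Relation.ReflTransGen (LocalGrowth η) K L) : K ⊆ L := by
  induction h with
  | refl => exact subset_rfl
  | tail _ h ih => exact ih.trans h.subset

open Relation in
theorem exists_localGrowth_of_cover {η : ℝ} (hη : 0 < η) (l : List E) :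
    ∀ κ > 0, ∃ δ > 0, ∀ K M : Set E, IsCompact K → K.Nonempty → StronglyConvexSet κ K →
      IsCompact M → StronglyConvexSet κ M → K ⊆ M → (∀ w ∈ M, ∃ y ∈ K, dist w y ≤ δ) →
      ∃ K', ReflTransGen (LocalGrowth η) K K' ∧ K' ⊆ M ∧
        ∀ c ∈ l, M ∩ closedBall c (η / 4) ⊆ K' := by
  induction l with
  | nil => exact fun κ _ => ⟨1, one_pos, fun K M _ _ _ _ _ hKM _ => ⟨K, .refl, hKM, by simp⟩⟩
  | cons c l ih =>
    intro κ hκ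
    obtain ⟨δ', hδ', ih⟩ := ih (κ / 2) (by positivity)
    refine ⟨min δ' (min (η / 4 / 8) (κ * (η / 4) ^ 2 / 16)), by positivity, ?_⟩
    intro K M hKc hne hK hMc hM hKM hMK
    set S := M ∩ closedBall c (η / 4)
    set K₁ := strongHull (κ / 2) (K ∪ S)
    have hM' := hM.mono (show κ / 2 ≤ κ by linarith)
    have hK₁M : K₁ ⊆ M := strongHull_subset hMc.isClosed hM' (union_subset hKM inter_subset_left)
    have hKK₁ : K ⊆ K₁ := subset_union_left.trans (subset_strongHull _ _)
    have hSK₁ : S ⊆ K₁ := subset_union_right.trans (subset_strongHull _ _)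
    have hK₁c : IsCompact K₁ := hMc.of_isClosed_subset (isClosed_strongHull _ _) hK₁M
    have hstep : LocalGrowth η K K₁ := by
      refine ⟨⟨hKc, hne, κ, hκ, hK⟩, ⟨hK₁c, hne.mono hKK₁, κ / 2, by positivity,
        stronglyConvexSet_strongHull _ _⟩, hKK₁, ?_⟩
      have hloc : ∀ z ∈ K₁, z ∉ K → ∃ s ∈ S, dist z s ≤ η / 4 := fun z hz hzK =>
        exists_dist_le_of_mem_strongHull hκ hK hKc.isComplete hne hM hMc.isClosed hKM
          inter_subset_left ((min_le_right _ _).trans (min_le_left _ _))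
          ((min_le_right _ _).trans (min_le_right _ _)) (by positivity) hMK hz hzK
      by_cases h : K₁ ⊆ K
      · obtain ⟨q, hq⟩ := hne
        exact ⟨q, hq, h.trans subset_union_left⟩
      · obtain ⟨z, hz, hzK⟩ := not_subset.1 h
        obtain ⟨s, hs, -⟩ := hloc z hz hzK
        obtain ⟨q, hq, hsq⟩ := hMK s hs.1
        refine ⟨q, hq, fun w hw => or_iff_not_imp_left.2 fun hwK => ?_⟩
        obtain ⟨s', hs', hws'⟩ := hloc w hw hwK
        have h1 := mem_closedBall.1 hs.2
        have h2 := mem_closedBall.1 hs'.2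
        have h3 : dist s q ≤ η / 4 / 8 := hsq.trans ((min_le_right _ _).trans (min_le_left _ _))
        rw [mem_closedBall]
        linarith [dist_triangle4 w s' s q, dist_triangle_right s' s c]
    obtain ⟨K', hgrow, hK'M, hcov⟩ := ih K₁ M hK₁c (hne.mono hKK₁)
      (stronglyConvexSet_strongHull _ _) hMc hM' hK₁M fun w hw => by
        obtain ⟨y, hy, hwy⟩ := hMK w hw
        exact ⟨y, hKK₁ hy, hwy.trans (min_le_left _ _)⟩
    refine ⟨K', .head hstep hgrow, hK'M, ?_⟩
    have hK₁K' : K₁ ⊆ K' := subset_of_reflTransGen_localGrowth hgrow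
    intro d hd
    rcases List.mem_cons.1 hd with rfl | hd
    · exact hSK₁.trans hK₁K'
    · exact hcov d hd

open Relation in
theorem reflTransGen_localGrowth {η : ℝ} (hη : 0 < η) (hK : IsStrongBody K) (hL : IsStrongBody L)
    (hKL : K ⊆ L) : ReflTransGen (LocalGrowth η) K L := by
  obtain ⟨κ₁, hκ₁, hK'⟩ := hK.exists_modulus
  obtain ⟨κ₂, hκ₂, hL'⟩ := hL.exists_modulus
  set κ := min κ₁ κ₂
  have hκ : 0 < κ := by positivity
  replace hK' := hK'.mono (min_le_left κ₁ κ₂)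
  replace hL' := hL'.mono (min_le_right κ₁ κ₂)
  obtain ⟨t, -, htfin, ht⟩ := hL.isCompact.finite_cover_balls (show 0 < η / 4 by positivity)
  obtain ⟨δ, hδ, hgrow⟩ := exists_localGrowth_of_cover hη htfin.toFinset.toList κ hκ
  obtain ⟨D, hD⟩ := isBounded_iff.1 hL.isCompact.isBounded
  obtain ⟨m, hm⟩ := exists_nat_gt (D / δ)
  have hm1 : D ≤ δ * (m + 1 : ℕ) := by
    rw [div_lt_iff₀ hδ] at hm
    push_cast
    nlinarith
  set s : ℕ → ℝ := fun j => j / (m + 1 : ℕ) with hs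
  have hm0 : (0 : ℝ) < (m + 1 : ℕ) := by positivity
  have hs0 : ∀ j, 0 ≤ s j := fun j => by positivity
  have hs1 : ∀ j ≤ m + 1, s j ≤ 1 := fun j hj => by
    rw [hs, div_le_one hm0]
    exact_mod_cast hj
  have hsucc : ∀ j, s (j + 1) = s j + 1 / (m + 1 : ℕ) := fun j => by
    simp only [hs]
    push_cast
    ring
  have hcomb : ∀ j ≤ m + 1, interpolate K L (s j) ⊆ L := fun j hj => by
    refine (interpolate_mono hKL hL.convex (hs0 j) (hs1 j hj)).trans ?_
    rw [interpolate_one hK.nonempty]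
  have main : ∀ j ≤ m + 1, ReflTransGen (LocalGrowth η) K (interpolate K L (s j)) := by
    intro j
    induction j with
    | zero =>
      intro _
      have : s 0 = 0 := by simp [hs]
      rw [this, interpolate_zero hL.nonempty]
    | succ j ih =>
      intro hj
      refine (ih (by omega)).trans ?_
      have hle : s j ≤ s (j + 1) := by
        rw [hsucc]
        have : 0 ≤ 1 / ((m + 1 : ℕ) : ℝ) := by positivity
        linarith
      obtain ⟨K', hK', hK'M, hcov⟩ := hgrow (interpolate K L (s j)) (interpolate K L (s (j + 1)))
        (isCompact_interpolate hK.isCompact hL.isCompact _)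
        ((hK.nonempty.prod hL.nonempty).image _)
        (hK'.interpolate hκ.le hL' (hs0 j) (hs1 j (by omega)))
        (isCompact_interpolate hK.isCompact hL.isCompact _)
        (hK'.interpolate hκ.le hL' (hs0 _) (hs1 _ hj))
        (interpolate_mono hKL hL.convex (hs0 j) hle) (by
          rintro _ ⟨⟨x, y⟩, ⟨hx, hy⟩, rfl⟩
          refine ⟨_, ⟨⟨x, y⟩, ⟨hx, hy⟩, rfl⟩, ?_⟩
          have : (1 - s (j + 1)) • x + s (j + 1) • y - ((1 - s j) • x + s j • y)
              = (1 / ((m + 1 : ℕ) : ℝ)) • (y - x) := by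
            rw [hsucc]
            module
          simp only
          rw [dist_eq_norm, this, norm_smul, Real.norm_of_nonneg (by positivity), ← dist_eq_norm,
            one_div, inv_mul_le_iff₀ hm0, mul_comm]
          exact (hD hy (hKL hx)).trans hm1)
      have : K' = interpolate K L (s (j + 1)) := by
        refine hK'M.antisymm fun z hz => ?_
        obtain ⟨c, hc, hzc⟩ := mem_iUnion₂.1 (ht (hcomb _ hj hz))
        exact hcov c (by simpa using hc) ⟨hz, ball_subset_closedBall hzc⟩
      rwa [← this]
  have h := main (m + 1) le_rfl
  have h1 : s (m + 1) = 1 := div_self hm0.ne'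
  rwa [h1, interpolate_one hK.nonempty] at h

/-- A step of size `ε` between convex footprints with a marked point: the footprint grows and the
point moves, both within distance `ε` of the point. -/
structure MarkedStep (ε : ℝ) (u v : Set E × E) : Prop where
  left : IsStrongBody u.1
  right : IsStrongBody v.1
  left_mem : u.2 ∈ u.1
  right_mem : v.2 ∈ v.1
  subset : u.1 ⊆ v.1
  subset_union : v.1 ⊆ u.1 ∪ closedBall u.2 ε
  dist_le : dist v.2 u.2 ≤ ε

theorem MarkedStep.refl_left {ε : ℝ} {u v : Set E × E} (h : MarkedStep ε u v) {η : ℝ}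
    (hη : 0 ≤ η) : MarkedStep η u u :=
  ⟨h.left, h.left, h.left_mem, h.left_mem, subset_rfl, subset_union_left, by simpa⟩

theorem MarkedStep.refl_right {ε : ℝ} {u v : Set E × E} (h : MarkedStep ε u v) {η : ℝ}
    (hη : 0 ≤ η) : MarkedStep η v v :=
  ⟨h.right, h.right, h.right_mem, h.right_mem, subset_rfl, subset_union_left, by simpa⟩

/-- A marked step of size `ε` whose marked points lie in the ball of radius `ρ` about `c`. -/
def MarkedStepIn (c : E) (ρ ε : ℝ) (u v : Set E × E) : Prop :=
  MarkedStep ε u v ∧ u.2 ∈ closedBall c ρ ∧ v.2 ∈ closedBall c ρ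

open Relation in
theorem reflTransGen_move {c : E} {ρ ε : ℝ} (hε : 0 < ε) (hK : IsStrongBody K) {x y : E}
    (hx : x ∈ K) (hy : y ∈ K) (hxc : x ∈ closedBall c ρ) (hyc : y ∈ closedBall c ρ) :
    ReflTransGen (MarkedStepIn c ρ ε) (K, x) (K, y) := by
  obtain ⟨m, hm⟩ := exists_nat_gt (dist y x / ε)
  have hm1 : dist y x ≤ ε * (m + 1 : ℕ) := by
    rw [div_lt_iff₀ hε] at hm
    push_cast
    nlinarith
  have hm0 : (0 : ℝ) < (m + 1 : ℕ) := by positivity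
  set p : ℕ → E := fun j => AffineMap.lineMap x y ((j : ℝ) / (m + 1 : ℕ)) with hp
  have hmem : ∀ j ≤ m + 1, p j ∈ K ∩ closedBall c ρ := fun j hj =>
    (hK.convex.inter (convex_closedBall c ρ)).lineMap_mem ⟨hx, hxc⟩ ⟨hy, hyc⟩
      ⟨by positivity, by rw [div_le_one hm0]; exact_mod_cast hj⟩
  have main : ∀ j ≤ m + 1, ReflTransGen (MarkedStepIn c ρ ε) (K, x) (K, p j) := by
    intro j
    induction j with
    | zero =>
      intro _
      have : p 0 = x := by simp [hp]
      rw [this]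
    | succ j ih =>
      intro hj
      have h1 := hmem j (by omega)
      have h2 := hmem (j + 1) hj
      refine (ih (by omega)).tail ⟨⟨hK, hK, h1.1, h2.1, subset_rfl, subset_union_left, ?_⟩,
        h1.2, h2.2⟩
      simp only [hp]
      rw [dist_lineMap_lineMap, Real.dist_eq, dist_comm x y]
      have : ((j + 1 : ℕ) : ℝ) / (m + 1 : ℕ) - j / (m + 1 : ℕ) = 1 / (m + 1 : ℕ) := by
        push_cast
        ring
      rw [this, abs_of_nonneg (by positivity), one_div, inv_mul_le_iff₀ hm0, mul_comm]
      exact hm1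
  have h := main (m + 1) le_rfl
  have h1 : p (m + 1) = y := by
    simp only [hp]
    rw [div_self hm0.ne', AffineMap.lineMap_apply_one]
  rwa [h1] at h

open Relation in
theorem MarkedStep.refine {ε η : ℝ} (hη : 0 < η) (hηε : η ≤ ε) {u v : Set E × E}
    (h : MarkedStep ε u v) : ReflTransGen (MarkedStepIn u.2 (2 * ε) η) u v := by
  have hgrow := reflTransGen_localGrowth hη h.left h.right h.subset
  have main : ∀ M, ReflTransGen (LocalGrowth η) u.1 M → M ⊆ v.1 → IsStrongBody M ∧
      ∃ w ∈ M ∩ closedBall u.2 (2 * ε), ReflTransGen (MarkedStepIn u.2 (2 * ε) η) u (M, w) := by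
    intro M hM
    induction hM with
    | refl =>
      exact fun _ => ⟨h.left, u.2, ⟨h.left_mem, mem_closedBall_self (by linarith)⟩, .refl⟩
    | @tail M M' hM hMM' ih =>
      intro hM'
      obtain ⟨hMb, w, hw, hpath⟩ := ih (hMM'.subset.trans hM')
      refine ⟨hMM'.right, ?_⟩
      by_cases hsub : M' ⊆ M
      · rw [hsub.antisymm hMM'.subset]
        exact ⟨w, hw, hpath⟩
      · obtain ⟨z, hz, hzM⟩ := not_subset.1 hsub
        obtain ⟨q, hq, hMq⟩ := hMM'.exists_near
        have hzq : dist z q ≤ η := (hMq hz).resolve_left hzM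
        have hqc : q ∈ closedBall u.2 (2 * ε) := by
          have hzu : z ∉ u.1 := fun hzu => hzM (subset_of_reflTransGen_localGrowth hM hzu)
          have : dist z u.2 ≤ ε := (h.subset_union (hM' hz)).resolve_left hzu
          rw [mem_closedBall]
          linarith [dist_triangle_left q u.2 z]
        refine ⟨q, ⟨hMM'.subset hq, hqc⟩, (hpath.trans
          (reflTransGen_move hη hMb hw.1 hq hw.2 hqc)).tail ⟨⟨hMb, hMM'.right, hq,
            hMM'.subset hq, hMM'.subset, hMq, ?_⟩, hqc, hqc⟩⟩
        simpa using hη.le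
  obtain ⟨hb, w, hw, hpath⟩ := main v.1 hgrow subset_rfl
  exact hpath.trans (reflTransGen_move hη hb hw.1 h.right_mem hw.2
    (mem_closedBall.2 (by linarith [h.dist_le, dist_nonneg.trans h.dist_le])))

end Growth

section Approximation

theorem exists_seq_of_reflTransGen {α : Type*} {r : α → α → Prop} (hr : ∀ a b, r a b → r b b)
    {u v : α} (hu : r u u) (h : Relation.ReflTransGen r u v) :
    ∃ (k : ℕ) (b : ℕ → α), b 0 = u ∧ (∀ j ≥ k, b j = v) ∧ ∀ j, r (b j) (b (j + 1)) := by
  induction h with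
  | refl => exact ⟨0, fun _ => u, rfl, fun _ _ => rfl, fun _ => hu⟩
  | @tail v w _ hvw ih =>
    obtain ⟨k, b, hb0, hbk, hb⟩ := ih
    refine ⟨k + 1, fun j => if j ≤ k then b j else w, by simpa using hb0, fun j hj => ?_,
      fun j => ?_⟩
    · simp [show ¬ j ≤ k by omega]
    · rcases lt_trichotomy j k with hj | rfl | hj
      · simpa [hj.le, Nat.succ_le_of_lt hj] using hb j
      · simpa [hbk j le_rfl] using hvw
      · simpa [show ¬ j ≤ k by omega, show ¬ j + 1 ≤ k by omega] using hr _ _ hvw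

variable {E : Type*} [NormedAddCommGroup E] [InnerProductSpace ℝ E] {B : Set E}

/-- A sequence of marked steps of size `ε` that starts at a point and after `P` steps has become
constant with footprint `B`. -/
structure IsApproximation (B : Set E) (ε : ℝ) (a : ℕ → Set E × E) (P : ℕ) : Prop where
  pos : 0 < P
  step : ∀ i, MarkedStep ε (a i) (a (i + 1))
  start : (a 0).1 = {(a 0).2}
  const : ∀ i ≥ P, a i = a P
  final : (a P).1 = B

theorem IsApproximation.refine {ε η : ℝ} (hη : 0 < η) (hηε : η ≤ ε) {a : ℕ → Set E × E} {P : ℕ}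
    (h : IsApproximation B ε a P) :
    ∃ k > 0, ∃ a', IsApproximation B η a' (P * k) ∧
      ∀ j, dist (a (j / k)).2 (a' j).2 ≤ 2 * ε := by
  have hε : 0 < ε := hη.trans_le hηε
  have hpath : ∀ i, ∃ (k : ℕ) (b : ℕ → Set E × E), b 0 = a i ∧ (∀ j ≥ k, b j = a (i + 1)) ∧
      ∀ j, MarkedStepIn (a i).2 (2 * ε) η (b j) (b (j + 1)) := fun i =>
    exists_seq_of_reflTransGen (fun _ _ h => ⟨h.1.refl_right hη.le, h.2.2, h.2.2⟩)
      ⟨(h.step i).refl_left hη.le, mem_closedBall_self (by positivity),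
        mem_closedBall_self (by positivity)⟩ ((h.step i).refine hη hηε)
  choose k b hb0 hbk hb using hpath
  set K := ∑ i ∈ Finset.range P, k i + 1
  have hkK : ∀ i < P, k i ≤ K := fun i hi =>
    (Finset.single_le_sum (f := k) (fun _ _ => Nat.zero_le _) (Finset.mem_range.2 hi)).trans
      (Nat.le_succ _)
  have hK0 : 0 < K := Nat.succ_pos _
  obtain ⟨c, hc0, hcK, hc, hcP⟩ : ∃ c : ℕ → ℕ → Set E × E, (∀ i, c i 0 = a i) ∧
      (∀ i, c i K = a (i + 1)) ∧ (∀ i j, MarkedStepIn (a i).2 (2 * ε) η (c i j) (c i (j + 1))) ∧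
      ∀ i ≥ P, ∀ j, c i j = a i := by
    refine ⟨fun i => if i < P then b i else fun _ => a i, fun i => ?_, fun i => ?_, fun i j => ?_,
      fun i hi j => ?_⟩
    · by_cases hi : i < P <;> simp [hi, hb0]
    · by_cases hi : i < P
      · simp [hi, hbk i K (hkK i hi)]
      · simp [hi, h.const i (by omega), h.const (i + 1) (by omega)]
    · by_cases hi : i < P
      · simpa [hi] using hb i j
      · simp only [hi, if_false]
        exact ⟨(h.step i).refl_left hη.le, mem_closedBall_self (by positivity),
          mem_closedBall_self (by positivity)⟩
    · simp [not_lt.2 hi]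
  have hfin : ∀ j ≥ P * K, c (j / K) (j % K) = a P := fun j hj => by
    have : P ≤ j / K := (Nat.le_div_iff_mul_le hK0).2 hj
    rw [hcP _ this, h.const _ this]
  refine ⟨K, hK0, fun j => c (j / K) (j % K), ⟨Nat.mul_pos h.pos hK0, fun j => ?_, ?_,
    fun j hj => ?_, ?_⟩, fun j => ?_⟩
  · have hdm : ∀ i r, r < K → (K * i + r) / K = i ∧ (K * i + r) % K = r := fun i r hr =>
      ⟨by rw [Nat.mul_add_div hK0, Nat.div_eq_of_lt hr, add_zero],
        by rw [Nat.mul_add_mod, Nat.mod_eq_of_lt hr]⟩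
    obtain ⟨i, r, hr, rfl⟩ : ∃ i r, r < K ∧ j = K * i + r :=
      ⟨j / K, j % K, Nat.mod_lt j hK0, (Nat.div_add_mod j K).symm⟩
    simp only [hdm i r hr]
    rcases Nat.lt_or_ge (r + 1) K with h1 | h1
    · rw [add_assoc, (hdm i (r + 1) h1).1, (hdm i (r + 1) h1).2]
      exact (hc i r).1
    · have hrK : r + 1 = K := by omega
      have hnext : K * i + r + 1 = K * (i + 1) + 0 := by rw [mul_add, mul_one]; omega
      rw [hnext, (hdm (i + 1) 0 hK0).1, (hdm (i + 1) 0 hK0).2, hc0, ← hcK, ← hrK]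
      exact (hc i r).1
  · simpa [hc0] using h.start
  · rw [hfin j hj, hfin _ le_rfl]
  · simp only [hfin _ le_rfl, h.final]
  · rw [dist_comm]
    exact (hc (j / K) (j % K)).2.1

theorem IsApproximation.monotone {ε : ℝ} {a : ℕ → Set E × E} {P : ℕ}
    (h : IsApproximation B ε a P) : Monotone fun i => (a i).1 :=
  monotone_nat_of_le_succ fun i => (h.step i).subset

theorem IsApproximation.exists_dist_le {ε : ℝ} (hε : 0 ≤ ε) {a : ℕ → Set E × E} {P : ℕ}
    (h : IsApproximation B ε a P) (i : ℕ) {z : E} (hz : z ∈ (a i).1) :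
    ∃ j ≤ i, dist z (a j).2 ≤ ε := by
  induction i with
  | zero =>
    rw [h.start] at hz
    exact ⟨0, le_rfl, by rw [mem_singleton_iff.1 hz]; simpa⟩
  | succ i ih =>
    rcases (h.step i).subset_union hz with hz | hz
    · obtain ⟨j, hj, hd⟩ := ih hz
      exact ⟨j, hj.trans (Nat.le_succ i), hd⟩
    · exact ⟨i, Nat.le_succ i, hz⟩

theorem IsApproximation.dist_le {ε : ℝ} (hε : 0 ≤ ε) {a : ℕ → Set E × E} {P : ℕ}
    (h : IsApproximation B ε a P) {i j : ℕ} (hij : i ≤ j + 1) (hji : j ≤ i + 1) :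
    dist (a i).2 (a j).2 ≤ ε := by
  rcases (by omega : i = j ∨ i = j + 1 ∨ j = i + 1) with rfl | rfl | rfl
  · simpa
  · exact (h.step j).dist_le
  · rw [dist_comm]
    exact (h.step i).dist_le

theorem exists_approximations {a : ℕ → Set E × E} (h : IsApproximation B 1 a 1) :
    ∃ (α : ℕ → ℕ → Set E × E) (P : ℕ → ℕ),
      (∀ n, IsApproximation B (1 / 2 ^ n) (α n) (P n)) ∧
      ∀ n, ∃ k > 0, P (n + 1) = P n * k ∧
        ∀ j, dist (α n (j / k)).2 (α (n + 1) j).2 ≤ 2 * (1 / 2 ^ n) := by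
  have hnext : ∀ n, ∀ s : {s : (ℕ → Set E × E) × ℕ // IsApproximation B (1 / 2 ^ n) s.1 s.2},
      ∃ s' : {s : (ℕ → Set E × E) × ℕ // IsApproximation B (1 / 2 ^ (n + 1)) s.1 s.2},
        ∃ k > 0, s'.1.2 = s.1.2 * k ∧
          ∀ j, dist (s.1.1 (j / k)).2 (s'.1.1 j).2 ≤ 2 * (1 / 2 ^ n) := by
    rintro n ⟨⟨a, P⟩, h⟩
    obtain ⟨k, hk, a', ha', hd⟩ := IsApproximation.refine (η := 1 / 2 ^ (n + 1)) (by positivity)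
      (one_div_pow_le_one_div_pow_of_le one_le_two n.le_succ) h
    exact ⟨⟨⟨a', P * k⟩, ha'⟩, k, hk, rfl, hd⟩
  choose g hg using hnext
  let F : ∀ n, {s : (ℕ → Set E × E) × ℕ // IsApproximation B (1 / 2 ^ n) s.1 s.2} :=
    fun n => Nat.rec ⟨(a, 1), by simpa using h⟩ g n
  exact ⟨fun n => (F n).1.1, fun n => (F n).1.2, fun n => (F n).2, fun n => hg n (F n)⟩

theorem exists_curve_with_convex_footprints [CompleteSpace E] {a : ℕ → Set E × E}
    (h : IsApproximation B 1 a 1) :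
    ∃ γ : ℝ → E, Continuous γ ∧ B ⊆ γ '' Icc 0 1 ∧ ∀ t, Convex ℝ (γ '' Icc 0 t) := by
  obtain ⟨α, P, hα, hnext⟩ := exists_approximations h
  have hP : ∀ n, (0 : ℝ) < P n := fun n => Nat.cast_pos.2 (hα n).pos
  have hε : ∀ n : ℕ, (0 : ℝ) ≤ 1 / 2 ^ n := fun n => by positivity
  set g : ℕ → ℝ → E := fun n t => (α n ⌊t * P n⌋₊).2 with hg
  have hdist : ∀ t n, dist (g n t) (g (n + 1) t) ≤ 4 / 2 / 2 ^ n := by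
    intro t n
    obtain ⟨k, hk, hPk, hd⟩ := hnext n
    have hk' : (k : ℝ) ≠ 0 := by positivity
    have hfloor : ⌊t * P n⌋₊ = ⌊t * P (n + 1)⌋₊ / k := by
      rw [← Nat.floor_div_natCast, hPk, Nat.cast_mul, ← mul_assoc, mul_div_cancel_right₀ _ hk']
    simp only [hg]
    rw [hfloor]
    refine (hd _).trans_eq (by ring)
  choose γ hγ using fun t => cauchySeq_tendsto_of_complete (cauchySeq_of_le_geometric_two (hdist t))
  have hγd : ∀ t n, dist (g n t) (γ t) ≤ 4 / 2 ^ n := fun t n =>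
    dist_le_of_le_geometric_two_of_tendsto (hdist t) (hγ t) n
  have hsmall : ∀ ε > 0, ∀ C : ℝ, ∃ n : ℕ, C / 2 ^ n < ε := by
    intro ε hε C
    obtain ⟨n, hn⟩ := pow_unbounded_of_one_lt (C / ε) one_lt_two
    refine ⟨n, ?_⟩
    rw [div_lt_iff₀ hε] at hn
    rw [div_lt_iff₀ (by positivity), mul_comm]
    exact hn
  have hcont : Continuous γ := by
    rw [Metric.continuous_iff]
    intro t ε hε'
    obtain ⟨n, hn⟩ := hsmall ε hε' 9
    refine ⟨1 / P n, one_div_pos.2 (hP n), fun s hs => ?_⟩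
    rw [Real.dist_eq, lt_div_iff₀ (hP n)] at hs
    have hfloor : ∀ x y : ℝ, |x - y| * P n < 1 → ⌊x * P n⌋₊ ≤ ⌊y * P n⌋₊ + 1 := by
      intro x y hxy
      have h1 : x * P n ≤ y * P n + 1 := by
        nlinarith [mul_le_mul_of_nonneg_right (le_abs_self (x - y)) (hP n).le]
      refine Nat.lt_succ_iff.1 ((Nat.floor_lt' (Nat.succ_ne_zero _)).2 ?_)
      have h2 := Nat.lt_floor_add_one (y * P n)
      push_cast
      linarith
    have hst : dist (g n s) (g n t) ≤ 1 / 2 ^ n :=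
      (hα n).dist_le (hε n) (hfloor s t hs) (hfloor t s (by rwa [abs_sub_comm]))
    calc dist (γ s) (γ t) ≤ 4 / 2 ^ n + 1 / 2 ^ n + 4 / 2 ^ n := by
          refine (dist_triangle4 _ (g n s) (g n t) _).trans ?_
          rw [dist_comm (γ s)]
          gcongr
          exacts [hγd s n, hγd t n]
      _ = 9 / 2 ^ n := by ring
      _ < ε := hn
  have happrox : ∀ (n : ℕ) (t : ℝ), 0 ≤ t → ∀ z ∈ (α n ⌊t * P n⌋₊).1, ∃ r ∈ Icc 0 t,
      dist z (γ r) ≤ 5 / 2 ^ n := by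
    intro n t ht z hz
    obtain ⟨j, hj, hd⟩ := (hα n).exists_dist_le (hε n) _ hz
    have hr : g n (j / P n) = (α n j).2 := by
      simp only [hg]
      rw [div_mul_cancel₀ _ (hP n).ne', Nat.floor_natCast]
    refine ⟨j / P n, ⟨by positivity, ?_⟩, ?_⟩
    · rw [div_le_iff₀ (hP n)]
      exact (Nat.le_floor_iff (by positivity)).1 hj
    · have h1 := hγd (j / P n) n
      rw [hr] at h1
      calc dist z (γ (j / P n)) ≤ 1 / 2 ^ n + 4 / 2 ^ n :=
            (dist_triangle _ _ _).trans (add_le_add hd h1)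
        _ = 5 / 2 ^ n := by ring
  have hclosed : ∀ t, IsClosed (γ '' Icc 0 t) := fun t => (isCompact_Icc.image hcont).isClosed
  refine ⟨γ, hcont, fun z hz => ?_, fun t => ?_⟩
  · refine (hclosed 1).closure_subset (Metric.mem_closure_iff.2 fun ε hε' => ?_)
    obtain ⟨n, hn⟩ := hsmall ε hε' 5
    obtain ⟨r, hr, hd⟩ := happrox n 1 zero_le_one z (by
      rw [one_mul, Nat.floor_natCast, (hα n).final]
      exact hz)
    exact ⟨γ r, mem_image_of_mem γ hr, hd.trans_lt hn⟩
  · rintro _ ⟨r, hr, rfl⟩ _ ⟨s, hs, rfl⟩ p q hp hq hpq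
    have ht : 0 ≤ t := hr.1.trans hr.2
    refine (hclosed t).closure_subset (Metric.mem_closure_iff.2 fun ε hε' => ?_)
    obtain ⟨n, hn⟩ := hsmall ε hε' 9
    have hmem : ∀ x ∈ Icc 0 t, g n x ∈ (α n ⌊t * P n⌋₊).1 := fun x hx =>
      (hα n).monotone (Nat.floor_mono (mul_le_mul_of_nonneg_right hx.2 (hP n).le))
        ((hα n).step _).left_mem
    obtain ⟨w, hw, hd⟩ := happrox n t ht _
      (((hα n).step _).left.convex (hmem r hr) (hmem s hs) hp hq hpq)
    refine ⟨γ w, mem_image_of_mem γ hw, lt_of_le_of_lt ?_ hn⟩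
    have hcomb : dist (p • γ r + q • γ s) (p • g n r + q • g n s) ≤ 4 / 2 ^ n := by
      refine (dist_add_add_le _ _ _ _).trans ?_
      rw [dist_smul₀, dist_smul₀, Real.norm_of_nonneg hp, Real.norm_of_nonneg hq, dist_comm (γ r),
        dist_comm (γ s)]
      calc p * dist (g n r) (γ r) + q * dist (g n s) (γ s)
          ≤ p * (4 / 2 ^ n) + q * (4 / 2 ^ n) := by
            gcongr
            exacts [hγd r n, hγd s n]
        _ = 4 / 2 ^ n := by rw [← add_mul, hpq, one_mul]
    calc dist (p • γ r + q • γ s) (γ w) ≤ 4 / 2 ^ n + 5 / 2 ^ n :=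
          (dist_triangle _ _ _).trans (add_le_add hcomb hd)
      _ = 9 / 2 ^ n := by ring

end Approximation

/-- There exists a Peano curve `γ : [0,1] → ℝ²` (a continuous map whose
image has nonempty interior) such that for every `t ∈ [0,1]` the footprint `γ([0,t])`
is a convex set. -/
theorem exists_peano_curve_with_convex_footprints :
    ∃ γ : ℝ → EuclideanSpace ℝ (Fin 2),
      ContinuousOn γ (Set.Icc 0 1) ∧
      (interior (γ '' Set.Icc 0 1)).Nonempty ∧
      ∀ t ∈ Set.Icc (0:ℝ) 1, Convex ℝ (γ '' Set.Icc 0 t) := by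
  have hpt : IsStrongBody {(0 : EuclideanSpace ℝ (Fin 2))} :=
    ⟨isCompact_singleton, singleton_nonempty 0, 1, one_pos, stronglyConvexSet_singleton 1 0⟩
  have hball : IsStrongBody (closedBall (0 : EuclideanSpace ℝ (Fin 2)) 1) :=
    ⟨isCompact_closedBall 0 1, ⟨0, by simp⟩, 1, one_pos,
      stronglyConvexSet_closedBall 0 zero_le_one (one_mul 1)⟩
  have hstep : MarkedStep 1 ({(0 : EuclideanSpace ℝ (Fin 2))}, 0) (closedBall 0 1, 0) :=
    ⟨hpt, hball, rfl, by simp, by simp, subset_union_right, by simp⟩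
  obtain ⟨γ, hγ, hsub, hconv⟩ := exists_curve_with_convex_footprints
    (B := closedBall (0 : EuclideanSpace ℝ (Fin 2)) 1)
    (a := fun i => if i = 0 then ({0}, 0) else (closedBall 0 1, 0))
    ⟨one_pos, fun i => by
      rcases i with _ | i
      · simpa using hstep
      · simpa using hstep.refl_right zero_le_one, rfl, fun i hi => by
      simp [show i ≠ 0 by omega], rfl⟩
  refine ⟨γ, hγ.continuousOn, ⟨0, ?_⟩, fun t _ => hconv t⟩
  exact mem_interior.2 ⟨ball 0 1, ball_subset_closedBall.trans hsub, isOpen_ball, by simp⟩
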